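/- Let p₀ ≠ p₁ be points of ℝ², let L be the line through p₀ and p₁, let σ denote the reflection of the plane across L, and let p₂, p₃ ∈ ℝ² be points not lying on L. Consider configurations q = (q₀, q₁, q₂, q₃) of four points in ℝ² satisfying the five edge-length equations dist(q₀, q₁) = dist(p₀, p₁), dist(q₀, q₂) = dist(p₀, p₂), dist(q₁, q₂) = dist(p₁, p₂), dist(q₀, q₃) = dist(p₀, p₃), dist(q₁, q₃) = dist(p₁, p₃). Then every such configuration is the image under some isometry of ℝ² of either (p₀, p₁, p₂, p₃) or (p₀, p₁, p₂, σ(p₃)), and these two configurations are not the image of one another under any isometry of ℝ². Hence the framework of two triangles sharing an edge has exactly two realizations up to congruence: one extended and one folded about the common edge. -/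

import Mathlib

noncomputable section

/-- The Euclidean plane ℝ². -/
abbrev Plane := EuclideanSpace ℝ (Fin 2)

/-- The orthogonal reflection of the plane across the line through `a` and `b`
(the affine span of `{a, b}`). -/
noncomputable def reflLine (a b : Plane) : Plane → Plane :=
  haveI : Nonempty (affineSpan ℝ ({a, b} : Set Plane)) :=
    ⟨⟨a, subset_affineSpan ℝ _ (by simp)⟩⟩
  EuclideanGeometry.reflection (affineSpan ℝ ({a, b} : Set Plane))

open EuclideanGeometry in
/-- For any two points there is an isometry taking the first to the second and fixing every point
equidistant from them, namely the reflection in their perpendicular bisector. -/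
theorem exists_isometryEquiv_map_eq_and_fix_of_dist_eq {V P : Type*} [NormedAddCommGroup V]
    [InnerProductSpace ℝ V] [FiniteDimensional ℝ V] [MetricSpace P] [NormedAddTorsor V P]
    (x y : P) :
    ∃ g : P ≃ᵢ P, g x = y ∧ ∀ c, dist c x = dist c y → g c = c := by
  have : Nonempty (AffineSubspace.perpBisector x y) :=
    ⟨⟨midpoint ℝ x y, AffineSubspace.midpoint_mem_perpBisector x y⟩⟩
  refine ⟨(reflection (AffineSubspace.perpBisector x y)).toIsometryEquiv, ?_, fun c hc => ?_⟩
  · have hv : x -ᵥ midpoint ℝ x y ∈ (AffineSubspace.perpBisector x y).directionᗮ := by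
      rw [AffineSubspace.direction_perpBisector, Submodule.orthogonal_orthogonal,
        left_vsub_midpoint, ← neg_vsub_eq_vsub_rev y x]
      exact Submodule.smul_mem _ _ (Submodule.neg_mem _ (Submodule.mem_span_singleton_self _))
    have h := reflection_orthogonal_vadd (AffineSubspace.midpoint_mem_perpBisector x y) hv
    rw [vsub_vadd] at h
    refine h.trans ?_
    rw [eq_comm, eq_vadd_iff_vsub_eq, right_vsub_midpoint, left_vsub_midpoint, ← smul_neg,
      neg_vsub_eq_vsub_rev]
  · exact (reflection_eq_self_iff c).2 (AffineSubspace.mem_perpBisector_iff_dist_eq.2 hc)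

/-- Two triangles with equal corresponding side lengths are related by an isometry. -/
theorem exists_isometryEquiv_of_triangle_dist_eq {V P : Type*} [NormedAddCommGroup V]
    [InnerProductSpace ℝ V] [FiniteDimensional ℝ V] [MetricSpace P] [NormedAddTorsor V P]
    {p₀ p₁ p₂ q₀ q₁ q₂ : P} (h01 : dist q₀ q₁ = dist p₀ p₁)
    (h02 : dist q₀ q₂ = dist p₀ p₂) (h12 : dist q₁ q₂ = dist p₁ p₂) :
    ∃ f : P ≃ᵢ P, f p₀ = q₀ ∧ f p₁ = q₁ ∧ f p₂ = q₂ := by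
  obtain ⟨f, hf, -⟩ := exists_isometryEquiv_map_eq_and_fix_of_dist_eq p₀ q₀
  obtain ⟨g, hg, hg'⟩ := exists_isometryEquiv_map_eq_and_fix_of_dist_eq (f p₁) q₁
  have hg₀ : g q₀ = q₀ := hg' q₀ (by rw [h01, ← f.dist_eq p₀ p₁, hf])
  obtain ⟨k, hk, hk'⟩ := exists_isometryEquiv_map_eq_and_fix_of_dist_eq (g (f p₂)) q₂
  have hk₀ : k q₀ = q₀ :=
    hk' q₀ (by rw [h02, ← f.dist_eq p₀ p₂, hf, ← g.dist_eq q₀ (f p₂), hg₀])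
  have hk₁ : k q₁ = q₁ :=
    hk' q₁ (by rw [h12, ← f.dist_eq p₁ p₂, ← g.dist_eq (f p₁), hg])
  exact ⟨(f.trans g).trans k, by simp [hf, hg₀, hk₀], by simp [hg, hk₁], by simp [hk]⟩

theorem dist_reflLine_of_mem {a b c : Plane} (hc : c ∈ affineSpan ℝ ({a, b} : Set Plane))
    (x : Plane) : dist c (reflLine a b x) = dist c x :=
  have : Nonempty (affineSpan ℝ ({a, b} : Set Plane)) := ⟨⟨c, hc⟩⟩
  EuclideanGeometry.dist_reflection_eq_of_mem _ hc x

theorem dist_left_reflLine (a b x : Plane) : dist a (reflLine a b x) = dist a x :=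
  dist_reflLine_of_mem (left_mem_affineSpan_pair ℝ a b) x

theorem dist_right_reflLine (a b x : Plane) : dist b (reflLine a b x) = dist b x :=
  dist_reflLine_of_mem (right_mem_affineSpan_pair ℝ a b) x

theorem reflLine_eq_self_iff {a b x : Plane} :
    reflLine a b x = x ↔ x ∈ affineSpan ℝ ({a, b} : Set Plane) :=
  haveI : Nonempty (affineSpan ℝ ({a, b} : Set Plane)) :=
    ⟨⟨a, left_mem_affineSpan_pair ℝ a b⟩⟩
  EuclideanGeometry.reflection_eq_self_iff x

/-- Up to reflection, a point off the line `ab` is determined by its distances to `a` and `b`. -/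
theorem eq_or_eq_reflLine_of_dist_eq {a b x y : Plane} (hab : a ≠ b)
    (hx : x ∉ affineSpan ℝ ({a, b} : Set Plane))
    (ha : dist a y = dist a x) (hb : dist b y = dist b x) : y = x ∨ y = reflLine a b x := by
  refine EuclideanGeometry.eq_of_dist_eq_of_dist_eq_of_finrank_eq_two
    (c₁ := a) (c₂ := b) (r₁ := dist a x) (r₂ := dist b x) (by simp) hab
    (fun h => hx (reflLine_eq_self_iff.1 h.symm)) (dist_comm _ _) ?_ ?_ (dist_comm _ _) ?_ ?_
  all_goals rw [dist_comm]
  exacts [dist_left_reflLine a b x, ha, dist_right_reflLine a b x, hb]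

/-- In the plane, two points equidistant from each of three affinely independent points agree. -/
theorem eq_of_dist_eq_of_notMem_affineSpan {a b c x y : Plane} (hab : a ≠ b)
    (hc : c ∉ affineSpan ℝ ({a, b} : Set Plane))
    (hax : dist a x = dist a y) (hbx : dist b x = dist b y) (hcx : dist c x = dist c y) :
    x = y := by
  have hi : AffineIndependent ℝ ![a, b, c] :=
    affineIndependent_of_ne_of_mem_of_mem_of_notMem hab (left_mem_affineSpan_pair ℝ a b)
      (right_mem_affineSpan_pair ℝ a b) hc
  have htop : affineSpan ℝ (Set.range ![a, b, c]) = ⊤ :=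
    hi.affineSpan_eq_top_iff_card_eq_finrank_add_one.2 (by simp)
  rw [← AffineSubspace.perpBisector_eq_top, eq_top_iff, ← htop, affineSpan_le]
  rintro _ ⟨i, rfl⟩
  rw [SetLike.mem_coe, AffineSubspace.mem_perpBisector_iff_dist_eq]
  fin_cases i
  exacts [hax, hbx, hcx]

/-- Two triangles sharing an edge have exactly two realizations up to congruence, one
extended and one folded about the common edge: every configuration `(q₀, q₁, q₂, q₃)`
satisfying the five edge-length equations is the image under some isometry of the plane
of either `(p₀, p₁, p₂, p₃)` or `(p₀, p₁, p₂, σ p₃)`, and these two configurations are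
not the image of one another under any isometry of the plane. -/
theorem double_triangle_two_realizations_up_to_congruence
    (p₀ p₁ p₂ p₃ : Plane) (h01 : p₀ ≠ p₁)
    (h2 : p₂ ∉ affineSpan ℝ ({p₀, p₁} : Set Plane))
    (h3 : p₃ ∉ affineSpan ℝ ({p₀, p₁} : Set Plane)) :
    (∀ q₀ q₁ q₂ q₃ : Plane,
      dist q₀ q₁ = dist p₀ p₁ →
      dist q₀ q₂ = dist p₀ p₂ → dist q₁ q₂ = dist p₁ p₂ →
      dist q₀ q₃ = dist p₀ p₃ → dist q₁ q₃ = dist p₁ p₃ →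
      ∃ f : Plane ≃ᵢ Plane,
        (q₀ = f p₀ ∧ q₁ = f p₁ ∧ q₂ = f p₂ ∧ q₃ = f p₃) ∨
        (q₀ = f p₀ ∧ q₁ = f p₁ ∧ q₂ = f p₂ ∧ q₃ = f (reflLine p₀ p₁ p₃))) ∧
    ¬ ∃ f : Plane ≃ᵢ Plane,
        f p₀ = p₀ ∧ f p₁ = p₁ ∧ f p₂ = p₂ ∧ f p₃ = reflLine p₀ p₁ p₃ := by
  refine ⟨fun q₀ q₁ q₂ q₃ d01 d02 d12 d03 d13 => ?_, ?_⟩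
  · obtain ⟨f, rfl, rfl, rfl⟩ := exists_isometryEquiv_of_triangle_dist_eq d01 d02 d12
    obtain ⟨r, rfl⟩ := f.surjective q₃
    rw [f.dist_eq] at d03 d13
    refine ⟨f, ?_⟩
    rcases eq_or_eq_reflLine_of_dist_eq h01 h3 d03 d13 with rfl | rfl
    · exact Or.inl ⟨rfl, rfl, rfl, rfl⟩
    · exact Or.inr ⟨rfl, rfl, rfl, rfl⟩
  · rintro ⟨f, hf0, hf1, hf2, hf3⟩
    refine h3 (reflLine_eq_self_iff.1 (eq_of_dist_eq_of_notMem_affineSpan h01 h2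
      (dist_left_reflLine _ _ _) (dist_right_reflLine _ _ _) ?_))
    rw [← hf3, ← f.dist_eq p₂ p₃, hf2]
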